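/- Let c : [0,∞) → [0,∞) be concave and nondecreasing with c(x) → 0 as x → 0, and let (a_i)_{i≥0} be a real sequence with |a_i| ≤ C ρ^i for some constants C > 0 and ρ ∈ (0,1). If ∫_0^1 c(t) / ( t √|log t| ) dt < ∞, then for every σ > 0 one has c( K ∑_{i≥0} |a_i| ) < ∞ for every finite K > 0 and ∑_{k≥1} k^{-1/2} c( 2σ ∑_{i≥k} |a_i| ) < ∞. In particular these conclusions hold whenever c(t) ≤ D |log t|^{-γ} near 0 for some D > 0 and γ > 1/2. -/

import Mathlib

open MeasureTheory Filter Topology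

noncomputable section

/-- A nonnegative concave function `f` on `[0, ∞)` satisfies `f (B x) ≤ B f x` for `B ≥ 1`. -/
theorem ConcaveOn.map_mul_le_mul_of_one_le {f : ℝ → ℝ} (hf : ConcaveOn ℝ (Set.Ici 0) f)
    (hf0 : 0 ≤ f 0) {B x : ℝ} (hB : 1 ≤ B) (hx : 0 ≤ x) : f (B * x) ≤ B * f x := by
  have hBpos : 0 < B := by linarith
  have hconc := hf.2 (Set.mem_Ici.2 (by positivity : 0 ≤ B * x)) (Set.mem_Ici.2 le_rfl)
    (inv_nonneg.2 hBpos.le) (sub_nonneg.2 (inv_le_one_of_one_le₀ hB)) (add_sub_cancel _ _)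
  simp only [smul_eq_mul, mul_zero, add_zero, inv_mul_cancel_left₀ hBpos.ne'] at hconc
  have hle : B⁻¹ * f (B * x) ≤ f x :=
    (le_add_of_nonneg_right
      (mul_nonneg (sub_nonneg.2 (inv_le_one_of_one_le₀ hB)) hf0)).trans hconc
  rwa [inv_mul_le_iff₀ hBpos] at hle

/-- The tail sums of a geometrically bounded sequence are geometrically bounded. -/
theorem tsum_abs_nat_add_le_of_geometric {a : ℕ → ℝ} {C ρ : ℝ} (hρ0 : 0 ≤ ρ) (hρ1 : ρ < 1)
    (ha : ∀ i, |a i| ≤ C * ρ ^ i) (n : ℕ) :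
    ∑' i, |a (n + i)| ≤ C * (1 - ρ)⁻¹ * ρ ^ n := by
  have hgeom : HasSum (fun i => C * ρ ^ n * ρ ^ i) (C * ρ ^ n * (1 - ρ)⁻¹) :=
    (hasSum_geometric_of_lt_one hρ0 hρ1).mul_left _
  have hle : ∀ i, |a (n + i)| ≤ C * ρ ^ n * ρ ^ i := fun i => by
    rw [mul_assoc, ← pow_add]
    exact ha _
  have hsum : Summable fun i => |a (n + i)| :=
    .of_nonneg_of_le (fun _ => abs_nonneg _) hle hgeom.summable
  exact (hsum.tsum_le_tsum hle hgeom.summable).trans_eq (by rw [hgeom.tsum_eq]; ring)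

/-- Summability of `k ^ (-1/2) * f (ρ ^ k)` transfers to the tail sums of a geometrically bounded
sequence, for `f` nonnegative, concave and nondecreasing. -/
theorem summable_mul_map_tail_of_summable_map_pow {f : ℝ → ℝ}
    (hfnonneg : ∀ x : ℝ, 0 ≤ x → 0 ≤ f x) (hfconc : ConcaveOn ℝ (Set.Ici 0) f)
    (hfmono : MonotoneOn f (Set.Ici 0)) {a : ℕ → ℝ} {C ρ : ℝ} (hρ0 : 0 < ρ) (hρ1 : ρ < 1)
    (ha : ∀ i, |a i| ≤ C * ρ ^ i)
    (hsum : Summable fun k : ℕ => ((k : ℝ) + 1) ^ (-(1 : ℝ) / 2) * f (ρ ^ (k + 1)))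
    {σ : ℝ} (hσ : 0 < σ) :
    Summable fun k : ℕ => ((k : ℝ) + 1) ^ (-(1 : ℝ) / 2) *
      f (2 * σ * ∑' i : ℕ, |a (k + 1 + i)|) := by
  set B : ℝ := max 1 (2 * σ * (C * (1 - ρ)⁻¹))
  have htail : ∀ k : ℕ, 0 ≤ 2 * σ * ∑' i : ℕ, |a (k + 1 + i)| := fun k =>
    mul_nonneg (by positivity) (tsum_nonneg fun _ => abs_nonneg _)
  refine .of_nonneg_of_le (fun k => mul_nonneg (by positivity) (hfnonneg _ (htail k)))
    (fun k => ?_) (hsum.mul_left B)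
  have hle : 2 * σ * ∑' i : ℕ, |a (k + 1 + i)| ≤ B * ρ ^ (k + 1) := calc
    _ ≤ 2 * σ * (C * (1 - ρ)⁻¹ * ρ ^ (k + 1)) := by
      gcongr
      exact tsum_abs_nat_add_le_of_geometric hρ0.le hρ1 ha (k + 1)
    _ = 2 * σ * (C * (1 - ρ)⁻¹) * ρ ^ (k + 1) := by ring
    _ ≤ B * ρ ^ (k + 1) := by
      gcongr
      exact le_max_right _ _
  have hf : f (2 * σ * ∑' i : ℕ, |a (k + 1 + i)|) ≤ B * f (ρ ^ (k + 1)) :=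
    (hfmono (Set.mem_Ici.2 (htail k)) (Set.mem_Ici.2 ((htail k).trans hle)) hle).trans
      (hfconc.map_mul_le_mul_of_one_le (hfnonneg 0 le_rfl) (le_max_left _ _) (by positivity))
  calc _ ≤ ((k : ℝ) + 1) ^ (-(1 : ℝ) / 2) * (B * f (ρ ^ (k + 1))) := by gcongr
    _ = _ := by ring

theorem abs_log_pow_of_lt_one {ρ : ℝ} (hρ0 : 0 < ρ) (hρ1 : ρ < 1) (n : ℕ) :
    |Real.log (ρ ^ n)| = n * -Real.log ρ := by
  rw [Real.log_pow, abs_mul, Nat.abs_cast, abs_of_neg (Real.log_neg hρ0 hρ1)]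

/-- The integral test: integrability of `f t / (t √|log t|)` near `0` controls the sum of
`k ^ (-1/2) * f (ρ ^ k)`. -/
theorem summable_map_pow_of_integrableOn {f : ℝ → ℝ} (hfnonneg : ∀ x : ℝ, 0 ≤ x → 0 ≤ f x)
    (hfmono : MonotoneOn f (Set.Ici 0)) {ρ : ℝ} (hρ0 : 0 < ρ) (hρ1 : ρ < 1)
    (hint : IntegrableOn (fun t : ℝ => f t / (t * Real.sqrt |Real.log t|)) (Set.Ioc (0 : ℝ) 1)) :
    Summable fun k : ℕ => ((k : ℝ) + 1) ^ (-(1 : ℝ) / 2) * f (ρ ^ (k + 1)) := by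
  set g : ℝ → ℝ := fun t => f t / (t * Real.sqrt |Real.log t|)
  set L : ℝ := -Real.log ρ
  have hL : 0 < L := neg_pos.2 (Real.log_neg hρ0 hρ1)
  set I : ℕ → Set ℝ := fun k => Set.Ioo (ρ ^ (k + 1)) (ρ ^ k)
  have hIsub : ∀ k, I k ⊆ Set.Ioc 0 1 := fun k t ht =>
    ⟨(pow_pos hρ0 _).trans ht.1, ht.2.le.trans (pow_le_one₀ hρ0.le hρ1.le)⟩
  have hdisj : Pairwise (Function.onFun Disjoint I) :=
    (pow_right_anti₀ hρ0.le hρ1.le).pairwise_disjoint_on_Ioo_succ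
  have hI : Summable fun k => ∫ t in I k, g t :=
    (hasSum_integral_iUnion (fun _ => measurableSet_Ioo) hdisj
      (hint.mono_set (Set.iUnion_subset hIsub))).summable
  refine .of_nonneg_of_le
    (fun k => mul_nonneg (by positivity) (hfnonneg _ (by positivity))) (fun k => ?_)
    (hI.mul_left (Real.sqrt L / (1 - ρ)))
  have hρk : 0 < ρ ^ k := pow_pos hρ0 k
  set m : ℝ := f (ρ ^ (k + 1)) / (ρ ^ k * Real.sqrt (((k : ℝ) + 1) * L))
  have hlower : ∀ t ∈ I k, m ≤ g t := fun t ht => by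
    have ht0 : 0 < t := (hIsub k ht).1
    have ht1 : t < 1 := ht.2.trans_le (pow_le_one₀ hρ0.le hρ1.le)
    have hlog : |Real.log t| ≤ ((k : ℝ) + 1) * L := by
      have hlt := Real.log_le_log (by positivity) ht.1.le
      rw [Real.log_pow] at hlt
      rw [abs_of_neg (Real.log_neg ht0 ht1)]
      push_cast at hlt
      linarith [show ((k : ℝ) + 1) * L = -(((k : ℝ) + 1) * Real.log ρ) from mul_neg _ _]
    have hlogpos : 0 < |Real.log t| := abs_pos.2 (Real.log_neg ht0 ht1).ne
    refine div_le_div₀ (hfnonneg t ht0.le)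
      (hfmono (Set.mem_Ici.2 (by positivity)) (Set.mem_Ici.2 ht0.le) ht.1.le) (by positivity) ?_
    gcongr
    exact ht.2.le
  have hmint : (1 - ρ) * ρ ^ k * m ≤ ∫ t in I k, g t := by
    have hmono := setIntegral_mono_on (μ := volume) (f := fun _ => m) (g := g) (s := I k)
      (integrableOn_const (by simp [I])) (hint.mono_set (hIsub k)) measurableSet_Ioo hlower
    rw [setIntegral_const, smul_eq_mul, Real.volume_real_Ioo_of_le
      (pow_le_pow_of_le_one hρ0.le hρ1.le k.le_succ)] at hmono
    calc _ = (ρ ^ k - ρ ^ (k + 1)) * m := by ring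
      _ ≤ _ := hmono
  have hρ : 0 < 1 - ρ := sub_pos.2 hρ1
  calc ((k : ℝ) + 1) ^ (-(1 : ℝ) / 2) * f (ρ ^ (k + 1))
      = Real.sqrt L / (1 - ρ) * ((1 - ρ) * ρ ^ k * m) := by
        have hsqrt : ((k : ℝ) + 1) ^ (-(1 : ℝ) / 2) = (Real.sqrt ((k : ℝ) + 1))⁻¹ := by
          rw [neg_div, Real.rpow_neg (by positivity), ← Real.sqrt_eq_rpow]
        have hsk : Real.sqrt ((k : ℝ) + 1) ≠ 0 := by positivity
        simp only [m]
        rw [hsqrt, Real.sqrt_mul (by positivity)]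
        field_simp
    _ ≤ _ := by gcongr

/-- A logarithmic modulus `f t ≤ D |log t| ^ (-γ)` with `γ > 1/2` makes `k ^ (-1/2) * f (ρ ^ k)`
summable. -/
theorem summable_map_pow_of_eventually_le_log {f : ℝ → ℝ} (hfnonneg : ∀ x : ℝ, 0 ≤ x → 0 ≤ f x)
    {ρ : ℝ} (hρ0 : 0 < ρ) (hρ1 : ρ < 1) {D γ : ℝ} (hγ : 1 / 2 < γ)
    (hlog : ∀ᶠ t in 𝓝[>] (0 : ℝ), f t ≤ D * |Real.log t| ^ (-γ)) :
    Summable fun k : ℕ => ((k : ℝ) + 1) ^ (-(1 : ℝ) / 2) * f (ρ ^ (k + 1)) := by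
  set L : ℝ := -Real.log ρ
  have hL : 0 < L := neg_pos.2 (Real.log_neg hρ0 hρ1)
  have hpow : Tendsto (fun k : ℕ => ρ ^ (k + 1)) atTop (𝓝[>] 0) :=
    tendsto_nhdsWithin_iff.2 ⟨(tendsto_pow_atTop_nhds_zero_of_lt_one hρ0.le hρ1).comp
      (tendsto_add_atTop_nat 1), .of_forall fun k => pow_pos hρ0 _⟩
  have hsum : Summable fun k : ℕ => D * L ^ (-γ) * ((k : ℝ) + 1) ^ (-(1 : ℝ) / 2 - γ) := by
    have hs := (summable_nat_add_iff 1).2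
      (Real.summable_nat_rpow (p := -(1 : ℝ) / 2 - γ) |>.2 (by linarith))
    push_cast at hs
    exact hs.mul_left _
  refine .of_norm_bounded_eventually_nat hsum ?_
  filter_upwards [hpow.eventually hlog] with k hk
  have hk1 : (0 : ℝ) < (k : ℝ) + 1 := by positivity
  rw [Real.norm_of_nonneg (mul_nonneg (by positivity) (hfnonneg _ (by positivity)))]
  rw [abs_log_pow_of_lt_one hρ0 hρ1, Real.mul_rpow (by positivity) hL.le] at hk
  push_cast at hk
  calc _ ≤ ((k : ℝ) + 1) ^ (-(1 : ℝ) / 2) * (D * (((k : ℝ) + 1) ^ (-γ) * L ^ (-γ))) := by gcongr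
    _ = _ := by
      rw [sub_eq_add_neg, Real.rpow_add hk1]
      ring

/-- Sufficient condition for condition (4.4) of the paper when the coefficients decay
geometrically: if `∫_0^1 c(t)/(t √|log t|) dt < ∞` then, for every `σ > 0`,
`c(K ∑_{i≥0} |a_i|)` is finite for every `K > 0` and
`∑_{k≥1} k^{-1/2} c(2σ ∑_{i≥k} |a_i|) < ∞`; in particular this holds whenever
`c(t) ≤ D |log t|^{-γ}` near `0` for some `D > 0`, `γ > 1/2`. -/
theorem Kac_condition_of_geometric_decay
    (cmod : ℝ → ℝ)
    (hcnonneg : ∀ x : ℝ, 0 ≤ x → 0 ≤ cmod x)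
    (hcconc : ConcaveOn ℝ (Set.Ici 0) cmod)
    (hcmono : MonotoneOn cmod (Set.Ici 0))
    (hc0 : Tendsto cmod (𝓝[Set.Ici 0] 0) (𝓝 0))
    (a : ℕ → ℝ) (C ρ : ℝ) (hC : 0 < C) (hρ0 : 0 < ρ) (hρ1 : ρ < 1)
    (ha : ∀ i : ℕ, |a i| ≤ C * ρ ^ i) :
    -- main implication
    (IntegrableOn (fun t : ℝ => cmod t / (t * Real.sqrt |Real.log t|))
        (Set.Ioc (0:ℝ) 1) →
      ∀ σ : ℝ, 0 < σ →
        (∀ K : ℝ, 0 < K → ∃ M : ℝ, cmod (K * ∑' i : ℕ, |a i|) ≤ M) ∧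
        Summable (fun k : ℕ => ((k : ℝ) + 1) ^ (-(1 : ℝ) / 2) *
          cmod (2 * σ * ∑' i : ℕ, |a (k + 1 + i)|))) ∧
    -- "in particular" clause
    (∀ D γ : ℝ, 0 < D → 1 / 2 < γ →
      (∀ᶠ t in 𝓝[>] (0:ℝ), cmod t ≤ D * |Real.log t| ^ (-γ)) →
      ∀ σ : ℝ, 0 < σ →
        (∀ K : ℝ, 0 < K → ∃ M : ℝ, cmod (K * ∑' i : ℕ, |a i|) ≤ M) ∧
        Summable (fun k : ℕ => ((k : ℝ) + 1) ^ (-(1 : ℝ) / 2) *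
          cmod (2 * σ * ∑' i : ℕ, |a (k + 1 + i)|))) := by
  refine ⟨fun hint σ hσ => ⟨fun K _ => ⟨_, le_rfl⟩, ?_⟩,
    fun D γ _ hγ hlog σ hσ => ⟨fun K _ => ⟨_, le_rfl⟩, ?_⟩⟩
  · exact summable_mul_map_tail_of_summable_map_pow hcnonneg hcconc hcmono hρ0 hρ1 ha
      (summable_map_pow_of_integrableOn hcnonneg hcmono hρ0 hρ1 hint) hσ
  · exact summable_mul_map_tail_of_summable_map_pow hcnonneg hcconc hcmono hρ0 hρ1 ha
      (summable_map_pow_of_eventually_le_log hcnonneg hρ0 hρ1 hγ hlog) hσ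

end
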